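/- arXiv:2602.03241 — 4 statements merged into one kernel-verified Lean document; each statement's English description precedes it below -/
import Mathlib

section
/- (Selberg–Mal'cev lemma) Let m be a positive natural number and let Γ be a finitely generated subgroup of the general linear group GL(m, ℂ). Then Γ is residually finite: for every γ ∈ Γ with γ ≠ 1 there exists a normal subgroup N of Γ of finite index such that γ ∉ N. -/
instance Int.isJacobsonRing : IsJacobsonRing ℤ := by
  refine isJacobsonRing_iff_prime_eq.2 fun P hP => ?_
  by_cases h : P = ⊥
  · subst h
    refine le_antisymm (fun x hx => ?_) Ideal.le_jacobson
    have hu := Int.isUnit_iff.1 (Ideal.mem_jacobson_bot.1 hx x)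
    have : x = 0 := by rcases hu with hu | hu <;> nlinarith
    simpa using this
  · have := hP.isMaximal h
    exact Ideal.jacobson_eq_self_of_isMaximal

/-- A field that is finitely generated as a ring is finite. -/
theorem finite_of_finiteType_int_field (K : Type*) [Field K] [h : Algebra ℤ K]
    [Algebra.FiniteType ℤ K] :
    Finite K := by
  obtain rfl : h = Ring.toIntAlgebra K := Subsingleton.elim _ _
  have : Module.Finite ℤ K := finite_of_finite_type_of_isJacobsonRing ℤ K
  obtain ⟨p, hp⟩ := CharP.exists K
  have hp0 : p ≠ 0 := by
    rintro rfl
    have : CharZero K := CharP.charP_to_charZero K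
    exact Int.not_isField
      (isField_of_isIntegral_of_isField (algebraMap ℤ K).injective_int (Field.toIsField K))
  refine Module.finite_of_fg_torsion K fun x => ⟨⟨p, by simpa using hp0⟩, ?_⟩
  simp [Submonoid.smul_def]

/-- A nonzero element of a domain that is finitely generated as a ring survives in some finite
residue field. -/
theorem exists_isMaximal_finite_quotient_notMem {A : Type*} [CommRing A] [IsDomain A]
    [Algebra.FiniteType ℤ A] {a : A} (ha : a ≠ 0) :
    ∃ I : Ideal A, I.IsMaximal ∧ Finite (A ⧸ I) ∧ a ∉ I := by
  have : IsJacobsonRing A := isJacobsonRing_of_finiteType (A := ℤ)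
  have hj : a ∉ (⊥ : Ideal A).jacobson := by
    rw [IsJacobsonRing.out ‹_› Ideal.isPrime_bot.isRadical]
    simpa using ha
  simp only [Ideal.jacobson, Ideal.mem_sInf, not_forall] at hj
  obtain ⟨I, ⟨-, hI⟩, haI⟩ := hj
  let _ : Field (A ⧸ I) := Ideal.Quotient.field I
  have : Algebra.FiniteType ℤ (A ⧸ I) :=
    Algebra.FiniteType.of_surjective (Ideal.Quotient.mkₐ ℤ I) Ideal.Quotient.mk_surjective
  exact ⟨I, hI, finite_of_finiteType_int_field _, haI⟩

/-- The matrices over a subalgebra, as a subalgebra of the matrices over the ambient ring, map to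
the matrix ring over the subalgebra. -/
def Subalgebra.matrixToMatrix {R B n : Type*} [CommRing R] [CommRing B] [Algebra R B]
    [Fintype n] [DecidableEq n] (A : Subalgebra R B) :
    A.matrix (n := n) →* Matrix n n A where
  toFun M := Matrix.of fun i j => ⟨M.1 i j, M.2 i j⟩
  map_one' := by
    ext i j
    by_cases h : i = j <;> simp [Matrix.one_apply, h]
  map_mul' M N := by
    ext i j
    simp [Matrix.mul_apply]

/-- The entries of the elements of a finitely generated linear group lie in a finitely generated
ring. -/
theorem exists_finiteType_subalgebra_entries_mem {B n : Type*} [CommRing B] [Fintype n]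
    [DecidableEq n] (Γ : Subgroup (GL n B)) (hfg : Group.FG Γ) :
    ∃ A : Subalgebra ℤ B, Algebra.FiniteType ℤ A ∧
      ∀ g : Γ, (g : GL n B).val ∈ A.matrix (n := n) := by
  obtain ⟨S, hS, hSfin⟩ := Submonoid.fg_iff _ |>.1 (Group.fg_iff_monoid_fg.1 hfg).fg_top
  let E : Set B := ⋃ g ∈ S, Set.range fun p : n × n => (g : GL n B).val p.1 p.2
  have hE : E.Finite := hSfin.biUnion fun g _ => Set.finite_range _
  refine ⟨Algebra.adjoin ℤ E, (Subalgebra.fg_iff_finiteType _).1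
    (Subalgebra.fg_def.2 ⟨E, hE, rfl⟩), fun g => ?_⟩
  have hg : g ∈ Submonoid.closure S := hS ▸ Submonoid.mem_top g
  induction hg using Submonoid.closure_induction with
  | mem g hg =>
    exact fun i j => Algebra.subset_adjoin (Set.mem_biUnion hg ⟨(i, j), rfl⟩)
  | one => exact one_mem _
  | mul g h _ _ hg hh => exact mul_mem hg hh

/-- **Selberg–Mal'cev lemma.** A finitely generated subgroup of `GL(m, ℂ)` is
residually finite: every nontrivial element avoids some finite-index normal subgroup. -/
theorem selberg_malcev_residually_finite
    (m : ℕ) (hm : 0 < m) (Γ : Subgroup (GL (Fin m) ℂ)) (hfg : Group.FG Γ) :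
    ∀ γ : Γ, γ ≠ 1 → ∃ N : Subgroup Γ, N.Normal ∧ N.FiniteIndex ∧ γ ∉ N := by
  intro γ hγ
  obtain ⟨A, hA, hmem⟩ := exists_finiteType_subalgebra_entries_mem Γ hfg
  let f : Γ →* Matrix (Fin m) (Fin m) A := A.matrixToMatrix.comp
    (((Units.coeHom _).comp Γ.subtype).codRestrict (A.matrix (n := Fin m)) hmem)
  have hf : f γ ≠ 1 := by
    refine fun h => hγ (Subtype.ext (Units.ext (Matrix.ext fun i j => ?_)))
    have hij := congrArg (fun M => ((M i j : A) : ℂ)) h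
    refine hij.trans ?_
    by_cases h : i = j <;> simp [Matrix.one_apply, h]
  obtain ⟨i, j, hij⟩ : ∃ i j, f γ i j - (1 : Matrix (Fin m) (Fin m) A) i j ≠ 0 := by
    by_contra! h
    exact hf (Matrix.ext fun i j => sub_eq_zero.1 (h i j))
  obtain ⟨I, -, hI, hIij⟩ := exists_isMaximal_finite_quotient_notMem hij
  let q : Γ →* (Matrix (Fin m) (Fin m) (A ⧸ I))ˣ :=
    ((Ideal.Quotient.mk I).mapMatrix.toMonoidHom.comp f).toHomUnits
  have : Finite (Matrix (Fin m) (Fin m) (A ⧸ I)) :=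
    inferInstanceAs (Finite (Fin m → Fin m → A ⧸ I))
  refine ⟨q.ker, inferInstance, Subgroup.finiteIndex_ker q, fun h => hIij ?_⟩
  have h1 : (Ideal.Quotient.mk I).mapMatrix (f γ) = (Ideal.Quotient.mk I).mapMatrix 1 := by
    rw [map_one]
    exact congrArg Units.val h
  exact Ideal.Quotient.eq.1 (congrFun (congrFun h1 i) j)
end

section
/- Let n be a natural number. Every finitely generated discrete subgroup Γ of PU(n+1,1) is residually finite: for every γ ∈ Γ with γ ≠ 1 there exists a normal subgroup N of Γ of finite index such that γ ∉ N. -/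
open Matrix

/-- The diagonal matrix `diag(-1, 1, …, 1)` defining the indefinite Hermitian form. -/
def Jmat (n : ℕ) : Matrix (Fin (n + 2)) (Fin (n + 2)) ℂ :=
  Matrix.diagonal fun i => if i = 0 then (-1 : ℂ) else 1

/-- The indefinite unitary group `U(n+1,1)` as a subgroup of `GL(n+2, ℂ)`. -/
def indefUnitaryGroup (n : ℕ) : Subgroup (GL (Fin (n + 2)) ℂ) where
  carrier := {A | (A.val)ᴴ * Jmat n * A.val = Jmat n}
  one_mem' := by simp
  mul_mem' := by
    intro A B hA hB
    simp only [Set.mem_setOf_eq] at hA hB ⊢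
    rw [Units.val_mul, conjTranspose_mul]
    calc B.valᴴ * A.valᴴ * Jmat n * (A.val * B.val)
        = B.valᴴ * (A.valᴴ * Jmat n * A.val) * B.val := by
          simp only [Matrix.mul_assoc]
      _ = Jmat n := by rw [hA, hB]
  inv_mem' := by
    intro A hA
    simp only [Set.mem_setOf_eq] at hA ⊢
    calc (A⁻¹.val)ᴴ * Jmat n * A⁻¹.val
        = (A⁻¹.val)ᴴ * (A.valᴴ * Jmat n * A.val) * A⁻¹.val := by rw [hA]
      _ = (A.val * A⁻¹.val)ᴴ * Jmat n * (A.val * A⁻¹.val) := by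
          simp only [conjTranspose_mul, Matrix.mul_assoc]
      _ = Jmat n := by rw [Units.mul_inv]; simp

/-- `PU(n+1,1)`: the quotient of `U(n+1,1)` by its center, with the quotient topology. -/
abbrev PU (n : ℕ) := (indefUnitaryGroup n) ⧸ Subgroup.center (indefUnitaryGroup n)

/-- A group that embeds in a residually finite group is residually finite. -/
theorem Group.ResiduallyFinite.of_injective {G G' : Type*} [Group G] [Group G']
    [Group.ResiduallyFinite G'] (f : G →* G') (hf : Function.Injective f) :
    Group.ResiduallyFinite G := by
  rw [Group.residuallyFinite_iff_forall_finiteIndexNormalSubgroup]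
  exact fun g hg => hf ((Group.eq_one_iff_forall_finiteIndexNormalSubroup (f g)
    fun K => hg (K.comap f)).trans (map_one f).symm)

theorem Int.isJacobsonRing_s2 : IsJacobsonRing ℤ := by
  refine isJacobsonRing_iff_prime_eq.2 fun P hP => ?_
  by_cases hbot : P = ⊥
  · subst hbot
    refine le_antisymm (fun x hx => ?_) Ideal.le_jacobson
    rcases Int.isUnit_iff.1 (Ideal.mem_jacobson_bot.1 hx x) with h | h
    · rw [Ideal.mem_bot]
      nlinarith
    · nlinarith [mul_self_nonneg x]
  · have := hP.isMaximal hbot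
    exact Ideal.jacobson_eq_self_of_isMaximal

/-- A field that is finitely generated as a ring is finite. -/
theorem Field.finite_of_finiteType_int (F : Type*) [Field F] [Algebra.FiniteType ℤ F] :
    Finite F := by
  have := Int.isJacobsonRing_s2
  have hfin : Module.Finite ℤ F := finite_of_finite_type_of_isJacobsonRing ℤ F
  have hinj : ¬ Function.Injective (algebraMap ℤ F) := fun h =>
    Int.not_isField (isField_of_isIntegral_of_isField h (Field.toIsField F))
  obtain ⟨a, ha, ha0⟩ : ∃ a : ℤ, algebraMap ℤ F a = 0 ∧ a ≠ 0 := by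
    rw [injective_iff_map_eq_zero] at hinj
    push Not at hinj
    exact hinj
  refine Module.finite_of_fg_torsion F fun x => ⟨⟨a, mem_nonZeroDivisors_of_ne_zero ha0⟩, ?_⟩
  change a • x = 0
  rw [Algebra.smul_def, ha, zero_mul]

/-- The general linear group over a reduced ring that is finitely generated as a ring is
residually finite. -/
theorem Matrix.GeneralLinearGroup.residuallyFinite_of_finiteType_int
    (ι R : Type*) [Fintype ι] [DecidableEq ι] [CommRing R] [IsReduced R]
    [Algebra.FiniteType ℤ R] : Group.ResiduallyFinite (GL ι R) := by
  have := Int.isJacobsonRing_s2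
  have hJ : IsJacobsonRing R := isJacobsonRing_of_finiteType (A := ℤ)
  refine Group.residuallyFinite_of_forall_exists_finite_monoidHom fun g hg => ?_
  obtain ⟨i, j, hij⟩ : ∃ i j, g.val i j - (1 : Matrix ι ι R) i j ≠ 0 := by
    by_contra! h
    exact hg (Units.ext (Matrix.ext fun i j => sub_eq_zero.1 (h i j)))
  obtain ⟨m, hm, hxm⟩ : ∃ m : Ideal R, m.IsMaximal ∧ g.val i j - (1 : Matrix ι ι R) i j ∉ m := by
    by_contra! h
    have hbot : (⊥ : Ideal R).jacobson = ⊥ := hJ.out' _ Ideal.isRadical_bot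
    have : g.val i j - (1 : Matrix ι ι R) i j ∈ (⊥ : Ideal R).jacobson :=
      Ideal.mem_sInf.2 fun {m} hm => h m hm.2
    rw [hbot] at this
    exact hij this
  have hft : Algebra.FiniteType ℤ (R ⧸ m) :=
    .of_surjective (Ideal.Quotient.mkₐ ℤ m) (Ideal.Quotient.mkₐ_surjective ℤ m)
  have : Finite (R ⧸ m) := @Field.finite_of_finiteType_int _ (Ideal.Quotient.field m) hft
  refine ⟨GL ι (R ⧸ m), inferInstance, inferInstance, map (Ideal.Quotient.mk m), fun h => hxm ?_⟩
  rw [← Ideal.Quotient.eq_zero_iff_mem, map_sub, sub_eq_zero]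
  refine (congrArg (fun A : GL ι (R ⧸ m) => A.val i j) h).trans ?_
  simp [Matrix.one_apply, apply_ite]

/-- **Malcev's theorem**: a finitely generated linear group is residually finite. -/
theorem Matrix.GeneralLinearGroup.residuallyFinite_of_fg
    {ι K : Type*} [Fintype ι] [DecidableEq ι] [Field K] (G : Subgroup (GL ι K)) (hG : G.FG) :
    Group.ResiduallyFinite G := by
  obtain ⟨S, rfl⟩ := hG
  let T : Set K := ⋃ g ∈ S, ⋃ i, ⋃ j, {g.val i j, g⁻¹.val i j}
  have hT : T.Finite := S.finite_toSet.biUnion fun g _ =>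
    Set.finite_iUnion fun i => Set.finite_iUnion fun j => Set.toFinite _
  let R := Algebra.adjoin ℤ T
  have : Algebra.FiniteType ℤ R := .adjoin_of_finite hT
  have hmem : ∀ g ∈ S, ∀ i j, g.val i j ∈ R ∧ g⁻¹.val i j ∈ R := fun g hg i j => by
    constructor <;> refine Algebra.subset_adjoin ?_ <;> simp only [T, Set.mem_iUnion] <;>
      exact ⟨g, hg, i, j, by simp⟩
  let f : GL ι R →* GL ι K := map (R.val : R →+* K)
  have hf : Function.Injective f :=
    Units.map_injective (Matrix.map_injective Subtype.val_injective)
  have hle : Subgroup.closure (S : Set (GL ι K)) ≤ f.range := by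
    rw [Subgroup.closure_le]
    intro g hg
    have hinj : Function.Injective fun A : Matrix ι ι R => A.map (R.val : R →+* K) :=
      Matrix.map_injective Subtype.val_injective
    refine ⟨⟨.of fun i j => ⟨g.val i j, (hmem g hg i j).1⟩,
      .of fun i j => ⟨g⁻¹.val i j, (hmem g hg i j).2⟩, hinj ?_, hinj ?_⟩, Units.ext rfl⟩
    · simp only [Matrix.map_mul, Matrix.map_one _ (map_zero _) (map_one _)]
      exact g.mul_inv
    · simp only [Matrix.map_mul, Matrix.map_one _ (map_zero _) (map_one _)]
      exact g.inv_mul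
  have := residuallyFinite_of_finiteType_int ι R
  exact .of_injective (G' := GL ι R)
    ((MonoidHom.ofInjective hf).symm.toMonoidHom.comp (Subgroup.inclusion hle))
    ((MonoidHom.ofInjective hf).symm.injective.comp (Subgroup.inclusion_injective hle))

/-- If every finitely generated subgroup of `U` is residually finite, then so is every finitely
generated subgroup of `U` modulo its center. -/
theorem Group.residuallyFinite_of_fg_quotient_center {U : Type*} [Group U]
    (hU : ∀ G : Subgroup U, G.FG → Group.ResiduallyFinite G)
    (Γ : Subgroup (U ⧸ Subgroup.center U)) (hΓ : Γ.FG) : Group.ResiduallyFinite Γ := by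
  rw [Group.residuallyFinite_iff_exists_finiteIndex]
  intro γ hγ
  let π := QuotientGroup.mk' (Subgroup.center U)
  have hπ : Function.Surjective π := QuotientGroup.mk'_surjective _
  obtain ⟨G₀, hG₀, hG₀Γ⟩ : ∃ G₀ : Subgroup U, G₀.FG ∧ G₀.map π = Γ := by
    classical
    obtain ⟨S, rfl⟩ := hΓ
    refine ⟨_, ⟨S.image (Function.surjInv hπ), rfl⟩, ?_⟩
    rw [MonoidHom.map_closure, Finset.coe_image, Set.image_image]
    simp only [Function.surjInv_eq, Set.image_id']
  obtain ⟨g, hg, hgγ⟩ : (γ : U ⧸ Subgroup.center U) ∈ G₀.map π := hG₀Γ ▸ γ.2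
  obtain ⟨u, hu⟩ : ∃ u, u * g ≠ g * u := by
    by_contra! h
    refine hγ (Subtype.ext ?_)
    rw [← hgγ]
    exact (QuotientGroup.eq_one_iff g).2 (Subgroup.mem_center_iff.2 h)
  let G : Subgroup U := G₀ ⊔ Subgroup.closure {u}
  have hG : G.FG := hG₀.sup ⟨{u}, by simp⟩
  have := hU G hG
  let g' : G := ⟨g, (le_sup_left : G₀ ≤ G) hg⟩
  let u' : G := ⟨u, (le_sup_right : _ ≤ G) (Subgroup.subset_closure rfl)⟩
  obtain ⟨N, hN⟩ := Group.exists_finiteIndexNormalSubgroup_notMem (g' * u' * g'⁻¹ * u'⁻¹) <| by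
    intro h
    rw [mul_inv_eq_one, mul_inv_eq_iff_eq_mul] at h
    exact hu (congrArg Subtype.val h).symm
  let f : G →* (G.map π) := π.subgroupMap G
  have hf : Function.Surjective f := π.subgroupMap_surjective G
  have hΓG : Γ ≤ G.map π := hG₀Γ ▸ Subgroup.map_mono le_sup_left
  have := N.isFiniteIndex'
  have hfin : (N.toSubgroup.map f).FiniteIndex :=
    ⟨ne_zero_of_dvd_ne_zero (Subgroup.FiniteIndex.index_ne_zero (H := N.toSubgroup))
      (N.toSubgroup.index_map_dvd hf)⟩
  let M : FiniteIndexNormalSubgroup (G.map π) := ⟨N.toSubgroup.map f, N.isNormal'.map f hf, hfin⟩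
  let M' := M.comap (Subgroup.inclusion hΓG)
  refine ⟨M'.toSubgroup, M'.isFiniteIndex', ?_⟩
  rintro ⟨n, hn, hnγ⟩
  have hng : π n = π g := by
    rw [hgγ]
    exact congrArg Subtype.val hnγ
  have hz : (n : U)⁻¹ * g ∈ Subgroup.center U := QuotientGroup.eq.1 hng
  have hcomm : u' * (n⁻¹ * g') = n⁻¹ * g' * u' := Subtype.ext (Subgroup.mem_center_iff.1 hz u)
  refine hN ?_
  have key : g' * u' * g'⁻¹ * u'⁻¹ = n * (u' * n⁻¹ * u'⁻¹) := by
    rw [show g' * u' = n * (n⁻¹ * g' * u') by group, ← hcomm]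
    group
  rw [key]
  exact mul_mem hn (N.isNormal'.conj_mem _ (inv_mem hn) _)

/-- Every finitely generated discrete subgroup of `PU(n+1,1)` is residually finite. -/
theorem residually_finite_of_fg_discrete_subgroup_PU
    (n : ℕ) (Γ : Subgroup (PU n)) (hdisc : DiscreteTopology Γ) (hfg : Group.FG Γ) :
    ∀ γ : Γ, γ ≠ 1 → ∃ N : Subgroup Γ, N.Normal ∧ N.FiniteIndex ∧ γ ∉ N := by
  have hU (G : Subgroup (indefUnitaryGroup n)) (hG : G.FG) : Group.ResiduallyFinite G := by
    have := Matrix.GeneralLinearGroup.residuallyFinite_of_fg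
      (G.map (indefUnitaryGroup n).subtype) (Subgroup.fg_iff_submonoid_fg _ |>.2 <|
        (Subgroup.fg_iff_submonoid_fg G |>.1 hG).map (indefUnitaryGroup n).subtype)
    let e := G.equivMapOfInjective _ (indefUnitaryGroup n).subtype_injective
    exact .of_injective e.toMonoidHom e.injective
  have := Group.residuallyFinite_of_fg_quotient_center hU Γ ((Group.fg_iff_subgroup_fg Γ).1 hfg)
  intro γ hγ
  obtain ⟨N, hN⟩ := Group.exists_finiteIndexNormalSubgroup_notMem γ hγ
  exact ⟨N.toSubgroup, N.isNormal', N.isFiniteIndex', hN⟩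
end

section
/- Let n ≥ 1 and 0 ≤ k ≤ n−1 be natural numbers. In ℂ^{n+1} with the Euclidean norm, let S^{2n+1} = {z ∈ ℂ^{n+1} : ‖z‖ = 1} and let S_ℝ^k = {z ∈ S^{2n+1} : z_j is real for every j, and z_j = 0 for every j with j ≥ k+1} (coordinates indexed by 0, 1, …, n). Then the complement S^{2n+1} \ S_ℝ^k, equipped with the subspace topology, is simply connected. -/
open Set Module Filter
open scoped unitInterval Topology

/-- A retract of a simply connected space is simply connected. -/
theorem SimplyConnectedSpace.of_leftInverse {X Y : Type*} [TopologicalSpace X]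
    [TopologicalSpace Y] [SimplyConnectedSpace Y] (i : C(X, Y)) (r : C(Y, X))
    (h : Function.LeftInverse r i) : SimplyConnectedSpace X := by
  rw [simply_connected_iff_loops_nullhomotopic]
  refine ⟨h.surjective.pathConnectedSpace r.continuous, fun x γ ↦ ?_⟩
  obtain ⟨F⟩ := SimplyConnectedSpace.paths_homotopic (γ.map i.continuous) (.refl (i x))
  exact ⟨{
    toFun := fun z ↦ r (F z)
    map_zero_left := by simp [h _]
    map_one_left := by simp [h _]
    prop' := by
      intro t s hs
      have := F.eq_fst t hs
      simp only [ContinuousMap.coe_mk] at this ⊢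
      rw [this]
      simp [h _] }⟩

section SubspaceComplement

variable {E : Type*} [NormedAddCommGroup E] [NormedSpace ℝ E] [FiniteDimensional ℝ E]
  {V : Submodule ℝ E}

/-- A `C¹` loop in the complement of a subspace of codimension at least three is
null-homotopic: a generic perturbation of the straight-line homotopy to the base point avoids
the subspace. -/
theorem Submodule.homotopic_refl_of_contDiff (hV : finrank ℝ V + 3 ≤ finrank ℝ E)
    {x : ↥(V : Set E)ᶜ} (γ : Path x x) {g : ℝ → E} (hg : ContDiff ℝ 1 g)
    (hgγ : ∀ s : I, g s = γ s) : γ.Homotopic (.refl x) := by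
  let τ : ℝ → ℝ → ℝ := fun t s ↦ t * (1 - t) * (s * (1 - s))
  let D : Set (ℝ × ℝ × V) := Ioo 0 1 ×ˢ (Ioo 0 1 ×ˢ univ)
  let f : ℝ × ℝ × V → E := fun z ↦
    (z.2.2 : E) - (τ z.1 z.2.1)⁻¹ • ((1 - z.1) • g z.2.1 + z.1 • (x : E))
  have τ_pos {t s : ℝ} (ht : t ∈ Ioo (0 : ℝ) 1) (hs : s ∈ Ioo (0 : ℝ) 1) : 0 < τ t s :=
    mul_pos (mul_pos ht.1 (sub_pos.2 ht.2)) (mul_pos hs.1 (sub_pos.2 hs.2))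
  have hf : ContDiffOn ℝ 1 f D := by
    have hτ : ContDiff ℝ 1 fun z : ℝ × ℝ × V ↦ τ z.1 z.2.1 := by
      simp only [τ]; fun_prop
    have hv : ContDiff ℝ 1 fun z : ℝ × ℝ × V ↦ (z.2.2 : E) :=
      V.subtypeL.contDiff.comp (contDiff_snd.comp contDiff_snd)
    refine hv.contDiffOn.sub ((hτ.contDiffOn.inv fun z hz ↦ (τ_pos hz.1 hz.2.1).ne').smul ?_)
    exact ContDiff.contDiffOn (by fun_prop)
  have hD : Convex ℝ D := (convex_Ioo _ _).prod ((convex_Ioo _ _).prod convex_univ)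
  obtain ⟨w, hw⟩ : ((f '' D)ᶜ).Nonempty := by
    refine (hf.dense_compl_image_of_dimH_lt_finrank hD subset_rfl ?_).nonempty
    calc dimH D ≤ dimH (univ : Set (ℝ × ℝ × V)) := dimH_mono (subset_univ _)
      _ = finrank ℝ (ℝ × ℝ × V) := Real.dimH_univ_eq_finrank _
      _ < finrank ℝ E := by
        rw [Nat.cast_lt, finrank_prod, finrank_prod, finrank_self]
        omega
  let H : I × I → E := fun z ↦
    (1 - z.1 : ℝ) • (γ z.2 : E) + (z.1 : ℝ) • (x : E) + τ z.1 z.2 • w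
  have hH : Continuous H := by
    simp only [H, τ]; fun_prop
  have mem_Ioo {t : I} (h0 : t ≠ 0) (h1 : t ≠ 1) : (t : ℝ) ∈ Ioo (0 : ℝ) 1 :=
    ⟨unitInterval.pos_iff_ne_zero.2 h0, unitInterval.lt_one_iff_ne_one.2 h1⟩
  have end_left (t : I) : H (t, 0) = x := by
    simp [H, τ, ← add_smul]
  have end_right (t : I) : H (t, 1) = x := by
    simp [H, τ, ← add_smul]
  have start (s : I) : H (0, s) = γ s := by simp [H, τ]
  have finish (s : I) : H (1, s) = x := by simp [H, τ]
  have mem (z : I × I) : H z ∈ (V : Set E)ᶜ := by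
    obtain ⟨t, s⟩ := z
    rcases eq_or_ne t 0 with rfl | ht0
    · rw [start]; exact (γ s).2
    rcases eq_or_ne t 1 with rfl | ht1
    · rw [finish]; exact x.2
    rcases eq_or_ne s 0 with rfl | hs0
    · rw [end_left]; exact x.2
    rcases eq_or_ne s 1 with rfl | hs1
    · rw [end_right]; exact x.2
    intro hz
    have ht := mem_Ioo ht0 ht1
    have hs := mem_Ioo hs0 hs1
    refine hw ⟨(t, s, (τ t s)⁻¹ • ⟨H (t, s), hz⟩), ⟨ht, hs, mem_univ _⟩, ?_⟩
    simp only [f, H, hgγ, Submodule.coe_smul]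
    rw [← smul_sub, add_sub_cancel_left, inv_smul_smul₀ (τ_pos ht hs).ne']
  exact ⟨{
    toFun := fun z ↦ ⟨H z, mem z⟩
    continuous_toFun := hH.subtype_mk _
    map_zero_left := fun s ↦ Subtype.ext (start s)
    map_one_left := fun s ↦ Subtype.ext (finish s)
    prop' := by
      rintro t s (rfl | rfl)
      · exact Subtype.ext (by simpa using end_left t)
      · exact Subtype.ext (by simpa using end_right t) }⟩

/-- Every loop in the complement of a subspace is homotopic to a polynomial loop. -/
theorem Submodule.exists_contDiff_homotopic {x : ↥(V : Set E)ᶜ} (γ : Path x x) :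
    ∃ (δ : Path x x) (g : ℝ → E), ContDiff ℝ 1 g ∧ (∀ s : I, g s = δ s) ∧
      γ.Homotopic δ := by
  let p : C(I, E) := ⟨fun s ↦ γ s, by fun_prop⟩
  have hopen : IsOpen {q : C(I, E) | MapsTo q univ (V : Set E)ᶜ} :=
    ContinuousMap.isOpen_setOfPred_mapsTo isCompact_univ V.closed_of_finiteDimensional.isOpen_compl
  obtain ⟨ε, hε, hball⟩ := Metric.isOpen_iff.1 hopen p fun s _ ↦ (γ s).2
  obtain ⟨n, hn, hn0⟩ := (((bernsteinApproximation_uniform p).eventually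
    (Metric.ball_mem_nhds p hε)).and (eventually_ne_atTop 0)).exists
  set q := bernsteinApproximation n p
  have hq0 : q 0 = x := by simp [q, p]
  have hq1 : q 1 = x := by simp [q, p, hn0]
  have mem (t : I) : (1 - t : ℝ) • p + (t : ℝ) • q ∈ Metric.ball p ε :=
    (convex_ball p ε) (Metric.mem_ball_self hε) hn (by unit_interval) t.2.1 (by ring)
  refine ⟨⟨⟨fun s ↦ ⟨q s, hball hn (mem_univ s)⟩, by fun_prop⟩, Subtype.ext hq0,
    Subtype.ext hq1⟩, fun s ↦ ∑ k : Fin (n + 1),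
      ((bernsteinPolynomial ℝ n k).eval s) • p (bernstein.z k), ?_, ?_, ?_⟩
  · exact ContDiff.sum fun k _ ↦ (by simpa using (bernsteinPolynomial ℝ n k).contDiff_aeval (𝕜 := ℝ) 1 :
      ContDiff ℝ 1 fun s ↦ (bernsteinPolynomial ℝ n k).eval s).smul contDiff_const
  · intro s
    exact (bernsteinApproximation.apply n p s).symm
  · exact ⟨{
      toFun := fun z ↦ ⟨((1 - z.1 : ℝ) • p + (z.1 : ℝ) • q) z.2, hball (mem z.1) (mem_univ z.2)⟩
      continuous_toFun := by
        refine Continuous.subtype_mk ?_ _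
        simp only [ContinuousMap.add_apply, ContinuousMap.smul_apply]
        fun_prop
      map_zero_left := fun s ↦ Subtype.ext (by simp [p])
      map_one_left := fun s ↦ Subtype.ext (by simp)
      prop' := by
        rintro t s (rfl | rfl)
        · exact Subtype.ext (by simp [p, hq0, ← add_smul])
        · exact Subtype.ext (by simp [p, hq1, ← add_smul]) }⟩

/-- The complement of a subspace of codimension at least three is simply connected. -/
theorem Submodule.isSimplyConnected_compl (hV : finrank ℝ V + 3 ≤ finrank ℝ E) :
    IsSimplyConnected (V : Set E)ᶜ := by
  rw [IsSimplyConnected, simply_connected_iff_loops_nullhomotopic,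
    ← isPathConnected_iff_pathConnectedSpace]
  refine ⟨isPathConnected_compl_of_one_lt_codim ?_, fun x γ ↦ ?_⟩
  · have := V.finrank_quotient_add_finrank
    rw [← finrank_eq_rank, Nat.one_lt_cast]
    omega
  · obtain ⟨δ, g, hg, hg_eq, hγ⟩ := exists_contDiff_homotopic γ
    exact hγ.trans (homotopic_refl_of_contDiff hV δ hg hg_eq)

/-- The complement in the unit sphere of a subspace of codimension at least three is simply
connected. -/
theorem Submodule.isSimplyConnected_sphere_diff (hV : finrank ℝ V + 3 ≤ finrank ℝ E) :
    IsSimplyConnected ({z : E | ‖z‖ = 1} \ V) := by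
  have := (V.isSimplyConnected_compl hV).simplyConnectedSpace
  have ne_zero (z : ↥(V : Set E)ᶜ) : ‖(z : E)‖ ≠ 0 := fun h ↦
    z.2 (by rw [norm_eq_zero.1 h]; exact V.zero_mem)
  refine SimplyConnectedSpace.of_leftInverse (Y := ↥(V : Set E)ᶜ)
    ⟨fun z ↦ ⟨z, z.2.2⟩, by fun_prop⟩
    ⟨fun z ↦ ⟨‖(z : E)‖⁻¹ • (z : E), ?_, ?_⟩, ?_⟩ ?_
  · simp [norm_smul, ne_zero z]
  · exact fun h ↦ z.2 ((V.smul_mem_iff (inv_ne_zero (ne_zero z))).1 h)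
  · exact ((continuous_subtype_val.norm.inv₀ ne_zero).smul continuous_subtype_val).subtype_mk _
  · intro z
    have hz : ‖(z : E)‖ = 1 := z.2.1
    exact Subtype.ext (by simp [hz])

end SubspaceComplement

/-- The real subspace `ℝ^m × {0}` of `ℂ^n`. -/
def realCoordinateSubspace (n m : ℕ) : Submodule ℝ (EuclideanSpace ℂ (Fin n)) where
  carrier := {z | (∀ j, (z j).im = 0) ∧ ∀ j : Fin n, m ≤ (j : ℕ) → z j = 0}
  zero_mem' := by simp
  add_mem' {a b} ha hb :=
    ⟨fun j ↦ by simp [ha.1 j, hb.1 j], fun j hj ↦ by simp [ha.2 j hj, hb.2 j hj]⟩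
  smul_mem' c {a} ha := ⟨fun j ↦ by simp [ha.1 j], fun j hj ↦ by simp [ha.2 j hj]⟩

theorem finrank_realCoordinateSubspace_le {n m : ℕ} (h : m ≤ n) :
    finrank ℝ (realCoordinateSubspace n m) ≤ m := by
  let φ : realCoordinateSubspace n m →ₗ[ℝ] (Fin m → ℝ) :=
    { toFun := fun z i ↦ ((z : EuclideanSpace ℂ (Fin n)) (Fin.castLE h i)).re
      map_add' := fun a b ↦ by ext; simp
      map_smul' := fun c a ↦ by ext; simp }
  have hφ : Function.Injective φ := by
    rintro ⟨a, ha⟩ ⟨b, hb⟩ hab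
    ext j
    by_cases hj : m ≤ (j : ℕ)
    · exact (ha.2 j hj).trans (hb.2 j hj).symm
    · exact Complex.ext (congrFun hab ⟨j, not_le.1 hj⟩) ((ha.1 j).trans (hb.1 j).symm)
  simpa using LinearMap.finrank_le_finrank_of_injective hφ

/-- The complement of the `ℝ`-sphere `S_ℝ^k` in the CR sphere `S^{2n+1}` is simply
connected when `0 ≤ k ≤ n - 1`. -/
theorem complement_real_sphere_simplyConnected (n k : ℕ) (hn : 1 ≤ n) (hk : k ≤ n - 1) :
    SimplyConnectedSpace
      ↥({z : EuclideanSpace ℂ (Fin (n + 1)) | ‖z‖ = 1} \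
        {z : EuclideanSpace ℂ (Fin (n + 1)) | ‖z‖ = 1 ∧ (∀ j, (z j).im = 0) ∧
          ∀ j : Fin (n + 1), k + 1 ≤ (j : ℕ) → z j = 0}) := by
  have hfin : finrank ℝ (EuclideanSpace ℂ (Fin (n + 1))) = 2 * (n + 1) := by
    rw [finrank_real_of_complex, finrank_euclideanSpace_fin]
  have hV := finrank_realCoordinateSubspace_le (n := n + 1) (m := k + 1) (by omega)
  have : FiniteDimensional ℝ (EuclideanSpace ℂ (Fin (n + 1))) :=
    FiniteDimensional.complexToReal _
  have key := (realCoordinateSubspace (n + 1) (k + 1)).isSimplyConnected_sphere_diff (by omega)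
  have hset : ({z : EuclideanSpace ℂ (Fin (n + 1)) | ‖z‖ = 1} \
      realCoordinateSubspace (n + 1) (k + 1)) = {z | ‖z‖ = 1} \
        {z | ‖z‖ = 1 ∧ (∀ j, (z j).im = 0) ∧ ∀ j : Fin (n + 1), k + 1 ≤ (j : ℕ) → z j = 0} :=
    Set.ext fun z ↦ and_congr_right fun hz ↦ not_congr (and_iff_right hz).symm
  exact (hset ▸ key).simplyConnectedSpace
end

section
/- Let n ≥ 3 and k ≥ 0 be natural numbers with 2k + 2 < n. In ℂ^{n+1} with the Euclidean norm, let S^{2n+1} = {z ∈ ℂ^{n+1} : ‖z‖ = 1} and let S_ℂ^{2k+1} = {z ∈ S^{2n+1} : z_j = 0 for every j with j ≥ k+1} (coordinates indexed by 0, 1, …, n). Then the complement S^{2n+1} \ S_ℂ^{2k+1}, equipped with the subspace topology, is simply connected. -/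
open scoped unitInterval

/-- A path in an open set of a real normed space is homotopic, within this set, to the restriction
of a `C¹` curve. -/
theorem IsOpen.exists_contDiff_path_homotopy {E : Type*} [NormedAddCommGroup E] [NormedSpace ℝ E]
    {s : Set E} (hs : IsOpen s) {x y : E} (p : Path x y) (hp : ∀ t, p t ∈ s) :
    ∃ (g : ℝ → E) (q : Path x y), ContDiff ℝ 1 g ∧ (∀ t : I, q t = g t) ∧
      ∃ F : p.Homotopy q, ∀ z, F z ∈ s := by
  obtain ⟨δ, hδ, hδs⟩ := (isCompact_range p.continuous).exists_thickening_subset_open hs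
    (Set.range_subset_iff.2 hp)
  have hlim := bernsteinApproximation_uniform (p : C(I, E))
  obtain ⟨n, hn, hn0⟩ := ((Metric.tendsto_nhds.1 hlim δ hδ).and
    (Filter.eventually_ne_atTop 0)).exists
  let q : Path x y :=
    { toContinuousMap := bernsteinApproximation n (p : C(I, E))
      source' := (bernsteinApproximation.apply_zero n _).trans p.source
      target' := (bernsteinApproximation.apply_one hn0 _).trans p.target }
  have hq (t : I) : dist (q t) (p t) < δ := (ContinuousMap.dist_apply_le_dist t).trans_lt hn
  refine ⟨fun t ↦ ∑ k : Fin (n + 1), (n.choose k * t ^ (k : ℕ) * (1 - t) ^ (n - k : ℕ)) •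
    p (bernstein.z k), q, by fun_prop, fun t ↦ ?_, ?_⟩
  · change bernsteinApproximation n (p : C(I, E)) t = _
    rw [bernsteinApproximation.apply]
    simp only [bernstein_apply]
    rfl
  · refine ⟨⟨ContinuousMap.Homotopy.affine (p : C(I, E)) (q : C(I, E)), ?_⟩, ?_⟩
    · rintro t z (rfl | rfl) <;> simp [ContinuousMap.Homotopy.affine]
    · rintro ⟨t, u⟩
      apply hδs
      have hball : Metric.ball (p u) δ ⊆ Metric.thickening δ (Set.range p) :=
        Metric.ball_subset_thickening (Set.mem_range_self u) δ
      apply hball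
      exact (convex_ball (p u) δ).segment_subset (Metric.mem_ball_self hδ) (hq u)
        (by
          rw [segment_eq_image_lineMap]
          exact ⟨t, t.2, rfl⟩)

/-- The set of points `y` such that the closed ray from `y` in the direction `v` avoids the
subspace `W` is star-shaped with respect to `v`. -/
theorem Submodule.starConvex_setOf_forall_add_smul_notMem {E : Type*} [AddCommGroup E] [Module ℝ E]
    (W : Submodule ℝ E) {v : E} (hv : v ∉ W) :
    StarConvex ℝ v {y | ∀ r : ℝ, 0 ≤ r → y + r • v ∉ W} := by
  rintro y hy a b ha hb hab r hr hmem
  rcases hb.eq_or_lt with rfl | hb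
  · have : (a • v + (0 : ℝ) • y + r • v) = (a + r) • v := by module
    rw [this, W.smul_mem_iff (by linarith)] at hmem
    exact hv hmem
  · refine hy ((a + r) / b) (by positivity) ?_
    have : a • v + b • y + r • v = b • (y + ((a + r) / b) • v) := by
      rw [smul_add, smul_smul, mul_div_cancel₀ _ hb.ne']
      module
    rwa [this, W.smul_mem_iff hb.ne'] at hmem

/-- The complement of a subspace of real codimension at least three is simply connected. -/
theorem Submodule.isSimplyConnected_compl_s8 {E : Type*} [NormedAddCommGroup E] [NormedSpace ℝ E]
    [FiniteDimensional ℝ E] (W : Submodule ℝ E)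
    (hW : Module.finrank ℝ W + 2 < Module.finrank ℝ E) :
    IsSimplyConnected (Wᶜ : Set E) := by
  rw [isSimplyConnected_iff_exists_homotopy_refl_forall_mem]
  refine ⟨isPathConnected_compl_of_one_lt_codim ?_, fun x p hp ↦ ?_⟩
  · have := W.finrank_quotient_add_finrank
    rw [← Module.finrank_eq_rank]
    exact_mod_cast (by omega : 1 < Module.finrank ℝ (E ⧸ W))
  obtain ⟨g, q, hg, hqg, F, hF⟩ :=
    W.closed_of_finiteDimensional.isOpen_compl.exists_contDiff_path_homotopy p hp
  have hqW (t : I) : q t ∉ W := by simpa using hF (1, t)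
  let f : W × ℝ × ℝ → E := fun z ↦ z.1 + z.2.1 • g z.2.2
  have hf : ContDiff ℝ 1 f :=
    (W.subtypeL.contDiff.comp contDiff_fst).add (by fun_prop)
  obtain ⟨v, hv⟩ : (Set.range f)ᶜ.Nonempty :=
    (hf.dense_compl_range_of_finrank_lt_finrank (by simpa using hW)).nonempty
  have hvW : v ∉ W := fun h ↦ hv ⟨(⟨v, h⟩, 0, 0), by simp [f]⟩
  set U : Set E := {y | ∀ r : ℝ, 0 ≤ r → y + r • v ∉ W}
  have hUW : U ⊆ (Wᶜ : Set E) := fun y hy h ↦ hy 0 le_rfl (by simpa using h)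
  have hqU (t : I) : q t ∈ U := by
    intro r hr hmem
    rcases hr.eq_or_lt with rfl | hr
    · exact hqW t (by simpa using hmem)
    · refine hv ⟨(⟨r⁻¹ • (q t + r • v), W.smul_mem _ hmem⟩, -r⁻¹, t), ?_⟩
      simp only [f, ← hqg, smul_add, smul_smul, inv_mul_cancel₀ hr.ne']
      module
  have : ContractibleSpace U :=
    (W.starConvex_setOf_forall_add_smul_notMem hvW).contractibleSpace ⟨_, hqU 0⟩
  have hU : IsSimplyConnected U := SimplyConnectedSpace.ofContractible U
  obtain ⟨G, hG⟩ := (isSimplyConnected_iff_exists_homotopy_refl_forall_mem.1 hU).2 x q hqU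
  refine ⟨F.trans G, fun z ↦ ?_⟩
  rw [Path.Homotopy.trans_apply]
  split_ifs
  · exact hF _
  · exact hUW (hG _)

/-- The complement of a subspace in the unit sphere is homotopy equivalent to the complement of
this subspace in the whole space. -/
noncomputable def Submodule.unitSphereDiffHomotopyEquivCompl {E : Type*} [NormedAddCommGroup E]
    [NormedSpace ℝ E] (W : Submodule ℝ E) :
    ContinuousMap.HomotopyEquiv ↥({z : E | ‖z‖ = 1} \ W) ↥(Wᶜ : Set E) :=
  have hne (y : ↥(Wᶜ : Set E)) : ‖(y : E)‖ ≠ 0 := fun h ↦ y.2 (by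
    rw [norm_eq_zero.1 h]
    exact W.zero_mem)
  have hinv : Continuous fun y : ↥(Wᶜ : Set E) ↦ ‖(y : E)‖⁻¹ :=
    continuous_subtype_val.norm.inv₀ hne
  { toFun := ⟨fun z ↦ ⟨z, z.2.2⟩, by fun_prop⟩
    invFun := ⟨fun y ↦ ⟨‖(y : E)‖⁻¹ • (y : E),
        by simp [norm_smul, hne y],
        fun h ↦ y.2 ((W.smul_mem_iff (inv_ne_zero (hne y))).1 h)⟩,
      by fun_prop⟩
    left_inv := by
      convert! ContinuousMap.Homotopic.refl _
      ext z
      have hz : ‖(z : E)‖ = 1 := z.2.1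
      simp [hz]
    right_inv :=
      ⟨{toFun := fun x ↦ ⟨((1 - (x.1 : ℝ)) * ‖(x.2 : E)‖⁻¹ + x.1) • (x.2 : E), fun h ↦ by
          have hpos : 0 < ‖(x.2 : E)‖⁻¹ := inv_pos.2 ((norm_nonneg _).lt_of_ne' (hne x.2))
          have h0 := x.1.2.1
          have h1 := x.1.2.2
          refine x.2.2 ((W.smul_mem_iff (ne_of_gt ?_)).1 h)
          rcases h0.eq_or_lt with h0 | h0
          · simpa [← h0] using hpos
          · exact add_pos_of_nonneg_of_pos (mul_nonneg (by linarith) hpos.le) h0⟩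
        continuous_toFun := by
          have := hinv.comp (continuous_snd (X := I))
          simp only [Function.comp_def] at this
          fun_prop
        map_zero_left := fun y ↦ by ext; simp
        map_one_left := fun y ↦ by ext; simp}⟩ }

/-- The subspace of vectors in `ℂ^{n+1}` whose coordinates of index at least `k + 1` vanish. -/
def coordinateSubspace (n k : ℕ) : Submodule ℝ (EuclideanSpace ℂ (Fin (n + 1))) where
  carrier := {z | ∀ j : Fin (n + 1), k + 1 ≤ (j : ℕ) → z j = 0}
  add_mem' := fun ha hb j hj ↦ by simp [ha j hj, hb j hj]
  zero_mem' := fun j _ ↦ by simp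
  smul_mem' := fun c z hz j hj ↦ by simp [hz j hj]

theorem finrank_coordinateSubspace_le {n k : ℕ} (hk : k ≤ n) :
    Module.finrank ℝ (coordinateSubspace n k) ≤ 2 * (k + 1) := by
  let f : coordinateSubspace n k →ₗ[ℝ] (Fin (k + 1) → ℂ) :=
    { toFun := fun z i ↦ (z : EuclideanSpace ℂ (Fin (n + 1))) (i.castLE (by omega))
      map_add' := fun _ _ ↦ by ext; simp
      map_smul' := fun _ _ ↦ by ext; simp }
  have hf : Function.Injective f := by
    rw [← LinearMap.ker_eq_bot, LinearMap.ker_eq_bot']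
    intro z hz
    ext j
    by_cases hj : k + 1 ≤ (j : ℕ)
    · exact z.2 j hj
    · exact congrFun hz ⟨j, by omega⟩
  have := LinearMap.finrank_le_finrank_of_injective hf
  rw [Module.finrank_pi_fintype] at this
  simpa [mul_comm] using this

/-- The complement of the `ℂ`-sphere `S_ℂ^{2k+1}` in the CR sphere `S^{2n+1}` is simply
connected when `2k + 2 < n`. -/
theorem complement_complex_sphere_simplyConnected (n k : ℕ) (hn : 3 ≤ n)
    (hk : 2 * k + 2 < n) :
    SimplyConnectedSpace
      ↥({z : EuclideanSpace ℂ (Fin (n + 1)) | ‖z‖ = 1} \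
        {z : EuclideanSpace ℂ (Fin (n + 1)) | ‖z‖ = 1 ∧
          ∀ j : Fin (n + 1), k + 1 ≤ (j : ℕ) → z j = 0}) := by
  have heq : {z : EuclideanSpace ℂ (Fin (n + 1)) | ‖z‖ = 1} \
      {z : EuclideanSpace ℂ (Fin (n + 1)) | ‖z‖ = 1 ∧
        ∀ j : Fin (n + 1), k + 1 ≤ (j : ℕ) → z j = 0} =
      {z : EuclideanSpace ℂ (Fin (n + 1)) | ‖z‖ = 1} \ coordinateSubspace n k := by
    ext z
    exact ⟨fun h ↦ ⟨h.1, fun hz ↦ h.2 ⟨h.1, hz⟩⟩, fun h ↦ ⟨h.1, fun hz ↦ h.2 hz.2⟩⟩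
  rw [heq]
  have hdim : Module.finrank ℝ (EuclideanSpace ℂ (Fin (n + 1))) = 2 * (n + 1) := by
    rw [finrank_real_of_complex, finrank_euclideanSpace_fin]
  have := finrank_coordinateSubspace_le (n := n) (k := k) (by omega)
  have := ((coordinateSubspace n k).isSimplyConnected_compl_s8 (by omega)).simplyConnectedSpace
  exact (coordinateSubspace n k).unitSphereDiffHomotopyEquivCompl.simplyConnectedSpace
end
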